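/- arXiv:1307.2148 — 8 statements merged into one kernel-verified Lean document; each statement's English description precedes it below -/
import Mathlib

section
/- Let S be a nonempty finite set and H : S × S → ℝ any function. Define Z_σ = ∑_{τ∈S} exp(−H(σ,τ)), the transition kernel P(σ,τ) = exp(−H(σ,τ))/Z_σ, the total sum Z = ∑_{σ∈S} Z_σ, and π(σ) = Z_σ/Z. If the weak balance condition ∑_{τ∈S} exp(−H(σ,τ)) = ∑_{τ∈S} exp(−H(τ,σ)) holds for every σ ∈ S, then π is a stationary distribution for P, i.e. ∑_{σ∈S} π(σ)·P(σ,τ) = π(τ) for every τ ∈ S. -/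
open Finset

/-- **Weak balance implies stationarity.**
For a PCA-type Markov chain on a finite state space `S` defined from a pair
Hamiltonian `H : S × S → ℝ` via `P σ τ = exp (-H (σ,τ)) / Zs σ` with
`Zs σ = ∑ τ, exp (-H (σ,τ))`, if the weak balance condition
`∑ τ, exp (-H (σ,τ)) = ∑ τ, exp (-H (τ,σ))` holds for every `σ`, then
`π σ = Zs σ / Z` (with `Z = ∑ σ, Zs σ`) is stationary for `P`. -/
theorem weak_balance_implies_stationary
    {S : Type*} [Fintype S] [Nonempty S] (H : S × S → ℝ)
    (Zs : S → ℝ) (hZs : ∀ σ, Zs σ = ∑ τ : S, Real.exp (-H (σ, τ)))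
    (P : S → S → ℝ) (hP : ∀ σ τ, P σ τ = Real.exp (-H (σ, τ)) / Zs σ)
    (Z : ℝ) (hZ : Z = ∑ σ : S, Zs σ)
    (π : S → ℝ) (hπ : ∀ σ, π σ = Zs σ / Z)
    (wbc : ∀ σ : S, ∑ τ : S, Real.exp (-H (σ, τ)) = ∑ τ : S, Real.exp (-H (τ, σ))) :
    ∀ τ : S, ∑ σ : S, π σ * P σ τ = π τ := by
  intro τ
  have hne (σ : S) : Zs σ ≠ 0 := by
    rw [hZs]
    exact (Finset.sum_pos (fun _ _ => Real.exp_pos _) Finset.univ_nonempty).ne'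
  calc ∑ σ : S, π σ * P σ τ = ∑ σ : S, Real.exp (-H (σ, τ)) / Z := by
        refine Finset.sum_congr rfl fun σ _ => ?_
        rw [hπ, hP, div_mul_div_comm, mul_comm Z, mul_div_mul_left _ _ (hne σ)]
    _ = π τ := by rw [← Finset.sum_div, ← wbc, ← hZs, hπ]
end

section
/- Fix an integer L ≥ 1, real numbers q and J_i for i ∈ ℤ/Lℤ. For the completely asymmetric 1D pair Hamiltonian H(σ,τ) = −∑_{i∈ℤ/Lℤ} (J_i σ_i τ_{i+1} + q σ_i τ_i), the weak balance condition holds: for every σ ∈ {−1,+1}^{ℤ/Lℤ}, ∑_{τ∈{−1,+1}^{ℤ/Lℤ}} exp(−H(σ,τ)) = ∑_{τ∈{−1,+1}^{ℤ/Lℤ}} exp(−H(τ,σ)). -/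
open Finset

/-- The partition function of independent `±1` spins in the site-dependent field `a` factorizes. -/
theorem sum_exp_sum_mul_spin {ι : Type*} [Fintype ι] [DecidableEq ι] (a : ι → ℝ) :
    ∑ τ : ι → ({-1, 1} : Finset ℝ), Real.exp (∑ i, a i * (τ i : ℝ)) =
      ∏ i, (Real.exp (-a i) + Real.exp (a i)) := by
  have h (i : ι) : Real.exp (-a i) + Real.exp (a i) =
      ∑ s : ({-1, 1} : Finset ℝ), Real.exp (a i * (s : ℝ)) := by
    rw [Finset.sum_coe_sort ({-1, 1} : Finset ℝ) (fun s => Real.exp (a i * s)),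
      Finset.sum_pair (by norm_num)]
    simp
  simp_rw [h, Real.exp_sum]
  rw [Finset.prod_univ_sum, Fintype.piFinset_univ]

/-- **Weak balance for the completely asymmetric 1D Ising PCA on the circle.**
For the Hamiltonian `H (σ,τ) = -∑ i, (J i * σ i * τ (i+1) + q * σ i * τ i)` on spin
configurations `σ : ℤ/Lℤ → {-1,1}`, the weak balance condition
`∑ τ, exp (-H (σ,τ)) = ∑ τ, exp (-H (τ,σ))` holds for every `σ`. -/
theorem one_d_circle_weak_balance (L : ℕ) [NeZero L] (q : ℝ) (J : ZMod L → ℝ)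
    (H : (ZMod L → ({-1, 1} : Finset ℝ)) → (ZMod L → ({-1, 1} : Finset ℝ)) → ℝ)
    (hH : ∀ σ τ, H σ τ =
      -∑ i : ZMod L, (J i * (σ i : ℝ) * (τ (i + 1) : ℝ) + q * (σ i : ℝ) * (τ i : ℝ))) :
    ∀ σ : ZMod L → ({-1, 1} : Finset ℝ),
      ∑ τ : ZMod L → ({-1, 1} : Finset ℝ), Real.exp (-H σ τ) =
        ∑ τ : ZMod L → ({-1, 1} : Finset ℝ), Real.exp (-H τ σ) := by
  intro σ
  have hl (τ : ZMod L → ({-1, 1} : Finset ℝ)) :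
      -H σ τ = ∑ i, (J (i - 1) * (σ (i - 1) : ℝ) + q * (σ i : ℝ)) * (τ i : ℝ) := by
    rw [hH, neg_neg, Finset.sum_add_distrib,
      ← (Equiv.subRight (1 : ZMod L)).sum_comp
        (fun i => J i * (σ i : ℝ) * (τ (i + 1) : ℝ)), ← Finset.sum_add_distrib]
    refine Finset.sum_congr rfl fun i _ => ?_
    simp only [Equiv.subRight_apply, sub_add_cancel]
    ring
  have hr (τ : ZMod L → ({-1, 1} : Finset ℝ)) :
      -H τ σ = ∑ i, (J i * (σ (i + 1) : ℝ) + q * (σ i : ℝ)) * (τ i : ℝ) := by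
    rw [hH, neg_neg]
    exact Finset.sum_congr rfl fun i _ => by ring
  simp_rw [hl, hr]
  rw [sum_exp_sum_mul_spin, sum_exp_sum_mul_spin, ← Equiv.prod_comp (Equiv.addRight (1 : ZMod L))]
  refine Finset.prod_congr rfl fun i _ => ?_
  simp only [Equiv.coe_addRight, add_sub_cancel_right]
  have hs (j : ZMod L) : (σ j : ℝ) = -1 ∨ (σ j : ℝ) = 1 := by
    have h := (σ j).2
    rwa [Finset.mem_insert, Finset.mem_singleton] at h
  rcases hs i with h | h <;> rcases hs (i + 1) with h' | h' <;> rw [h, h'] <;> ring_nf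
end

section
/- Fix an integer L ≥ 1, real numbers q and J_i for i ∈ ℤ/Lℤ. Consider the completely asymmetric 1D PCA on {−1,+1}^{ℤ/Lℤ} with H(σ,τ) = −∑_{i∈ℤ/Lℤ} (J_i σ_i τ_{i+1} + q σ_i τ_i), transition probabilities P(σ,τ) = exp(−H(σ,τ))/Z_σ where Z_σ = ∑_τ exp(−H(σ,τ)). Then the probability distribution π(σ) = ∏_{i∈ℤ/Lℤ} cosh(J_{i−1}σ_{i−1} + qσ_i) / ∑_{σ'} ∏_{i∈ℤ/Lℤ} cosh(J_{i−1}σ'_{i−1} + qσ'_i) is stationary: ∑_σ π(σ)P(σ,τ) = π(τ) for all τ. -/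
open Finset

/-- A sum of `exp` of a linear form over all spin configurations factorizes over sites. -/
theorem sum_spin_exp_linear {ι : Type*} [Fintype ι] [DecidableEq ι] (a : ι → ℝ) :
    ∑ σ : ι → ({-1, 1} : Finset ℝ), Real.exp (∑ i, a i * (σ i : ℝ)) =
      ∏ i, (2 * Real.cosh (a i)) := by
  have single (b : ℝ) :
      ∑ s : ({-1, 1} : Finset ℝ), Real.exp (b * (s : ℝ)) = 2 * Real.cosh b := by
    rw [Finset.sum_coe_sort ({-1, 1} : Finset ℝ) fun s => Real.exp (b * s),
      Finset.sum_pair (by norm_num), Real.cosh_eq]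
    simp only [mul_neg, mul_one]
    ring
  simp_rw [Real.exp_sum, ← single, Finset.prod_univ_sum, Fintype.piFinset_univ]

/-- For spins `s` and `t`, the hyperbolic cosine of `x * s + y * t` is symmetric in `s`, `t`. -/
theorem cosh_spin_comm (x y : ℝ) (s t : ({-1, 1} : Finset ℝ)) :
    Real.cosh (x * (s : ℝ) + y * (t : ℝ)) = Real.cosh (x * (t : ℝ) + y * (s : ℝ)) := by
  obtain ⟨s, hs⟩ := s
  obtain ⟨t, ht⟩ := t
  simp only [Finset.mem_insert, Finset.mem_singleton] at hs ht
  rcases hs with rfl | rfl <;> rcases ht with rfl | rfl <;> try rfl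
  all_goals
    rw [← Real.cosh_neg]
    congr 1
    ring

/-- **Explicit stationary distribution of the completely asymmetric 1D Ising PCA on
the circle.** For the PCA with Hamiltonian
`H (σ,τ) = -∑ i, (J i * σ i * τ (i+1) + q * σ i * τ i)` and transition probabilities
`P σ τ = exp (-H (σ,τ)) / Zs σ`, the distribution
`π σ = ∏ i, cosh (J (i-1) * σ (i-1) + q * σ i)` normalized over all configurations
is stationary: `∑ σ, π σ * P σ τ = π τ` for all `τ`. -/
theorem one_d_circle_stationary_distribution (L : ℕ) [NeZero L] (q : ℝ) (J : ZMod L → ℝ)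
    (H : (ZMod L → ({-1, 1} : Finset ℝ)) → (ZMod L → ({-1, 1} : Finset ℝ)) → ℝ)
    (hH : ∀ σ τ, H σ τ =
      -∑ i : ZMod L, (J i * (σ i : ℝ) * (τ (i + 1) : ℝ) + q * (σ i : ℝ) * (τ i : ℝ)))
    (Zs : (ZMod L → ({-1, 1} : Finset ℝ)) → ℝ)
    (hZs : ∀ σ, Zs σ = ∑ τ : ZMod L → ({-1, 1} : Finset ℝ), Real.exp (-H σ τ))
    (P : (ZMod L → ({-1, 1} : Finset ℝ)) → (ZMod L → ({-1, 1} : Finset ℝ)) → ℝ)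
    (hP : ∀ σ τ, P σ τ = Real.exp (-H σ τ) / Zs σ)
    (π : (ZMod L → ({-1, 1} : Finset ℝ)) → ℝ)
    (hπ : ∀ σ, π σ =
      (∏ i : ZMod L, Real.cosh (J (i - 1) * (σ (i - 1) : ℝ) + q * (σ i : ℝ))) /
        ∑ σ' : ZMod L → ({-1, 1} : Finset ℝ),
          ∏ i : ZMod L, Real.cosh (J (i - 1) * (σ' (i - 1) : ℝ) + q * (σ' i : ℝ))) :
    ∀ τ : ZMod L → ({-1, 1} : Finset ℝ),
      ∑ σ : ZMod L → ({-1, 1} : Finset ℝ), π σ * P σ τ = π τ := by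
  intro τ
  set W : (ZMod L → ({-1, 1} : Finset ℝ)) → ℝ := fun σ =>
    ∏ i : ZMod L, Real.cosh (J (i - 1) * (σ (i - 1) : ℝ) + q * (σ i : ℝ)) with hW
  have W_pos (σ) : 0 < W σ := Finset.prod_pos fun i _ => Real.cosh_pos _
  have sum_target (σ) : ∑ τ, Real.exp (-H σ τ) = 2 ^ Fintype.card (ZMod L) * W σ := by
    have linear (τ) : -H σ τ =
        ∑ i, (J (i - 1) * (σ (i - 1) : ℝ) + q * (σ i : ℝ)) * (τ i : ℝ) := by
      simp_rw [hH, neg_neg, add_mul, Finset.sum_add_distrib]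
      congr 1
      exact Fintype.sum_equiv (Equiv.addRight 1) _ _ fun i => by simp
    simp_rw [linear, sum_spin_exp_linear, Finset.prod_mul_distrib, hW]
    simp
  have sum_source : ∑ σ, Real.exp (-H σ τ) = 2 ^ Fintype.card (ZMod L) * W τ := by
    have linear (σ) : -H σ τ =
        ∑ i, (J i * (τ (i + 1) : ℝ) + q * (τ i : ℝ)) * (σ i : ℝ) := by
      rw [hH, neg_neg]
      exact Finset.sum_congr rfl fun i _ => by ring
    simp_rw [linear, sum_spin_exp_linear, Finset.prod_mul_distrib, hW]
    congr 1
    · simp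
    · refine Fintype.prod_equiv (Equiv.addRight 1) _ _ fun i => ?_
      simpa using cosh_spin_comm (J i) q (τ (i + 1)) (τ i)
  have term (σ) : π σ * P σ τ =
      Real.exp (-H σ τ) / (2 ^ Fintype.card (ZMod L) * ∑ σ', W σ') := by
    rw [hπ, hP, hZs, sum_target]
    change W σ / (∑ σ', W σ') * _ = _
    have := (W_pos σ).ne'
    field_simp
  simp_rw [term]
  rw [← Finset.sum_div, sum_source, hπ, mul_div_mul_left _ _ (by positivity)]
end

section
/- Fix an integer L ≥ 1, real numbers q and J_i for i ∈ ℤ/Lℤ. For the completely asymmetric 1D pair Hamiltonian on the circle, H(σ,τ) = −∑_{i∈ℤ/Lℤ} (J_i σ_i τ_{i+1} + q σ_i τ_i), the total partition function satisfies Z = ∑_{σ,τ∈{−1,+1}^{ℤ/Lℤ}} exp(−H(σ,τ)) = 4^L · ( (cosh q)^L ∏_{i∈ℤ/Lℤ} cosh J_i + (sinh q)^L ∏_{i∈ℤ/Lℤ} sinh J_i ). -/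
open Finset

theorem sum_spin (f : ℝ → ℝ) :
    ∑ s : ({-1, 1} : Finset ℝ), f s = f (-1) + f 1 := by
  rw [Finset.sum_coe_sort ({-1, 1} : Finset ℝ) f, Finset.sum_pair (by norm_num)]

theorem sum_prod_spin {ι : Type*} [Fintype ι] [DecidableEq ι] (f : ι → ℝ → ℝ) :
    ∑ σ : ι → ({-1, 1} : Finset ℝ), ∏ i, f i (σ i) = ∏ i, (f i (-1) + f i 1) := by
  rw [← Fintype.prod_sum (fun i (s : ({-1, 1} : Finset ℝ)) => f i s)]
  exact Finset.prod_congr rfl fun i _ => sum_spin (f i)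

theorem exp_mul_spin (a x : ℝ) (hx : x = -1 ∨ x = 1) :
    Real.exp (a * x) = Real.cosh a + Real.sinh a * x := by
  rcases hx with rfl | rfl
  · rw [mul_neg_one, mul_neg_one, ← sub_eq_add_neg, Real.cosh_sub_sinh]
  · rw [mul_one, mul_one, Real.cosh_add_sinh]

theorem spin_eq (s : ({-1, 1} : Finset ℝ)) : (s : ℝ) = -1 ∨ (s : ℝ) = 1 :=
  Finset.mem_insert.1 s.2 |>.imp_right Finset.mem_singleton.1

theorem eq_empty_or_univ_of_shift_invariant {L : ℕ} [NeZero L] (T : Finset (ZMod L))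
    (h : ∀ i, i ∈ T ↔ i - 1 ∈ T) : T = ∅ ∨ T = univ := by
  have key : ∀ n : ℕ, ((n : ZMod L) ∈ T ↔ (0 : ZMod L) ∈ T) := by
    intro n
    induction n with
    | zero => simp
    | succ n ih => rw [h, Nat.cast_succ, add_sub_cancel_right, ih]
  have key' : ∀ x : ZMod L, x ∈ T ↔ (0 : ZMod L) ∈ T := fun x => by
    simpa using key x.val
  by_cases h0 : (0 : ZMod L) ∈ T
  · exact Or.inr (Finset.eq_univ_iff_forall.2 fun x => (key' x).2 h0)
  · exact Or.inl (Finset.eq_empty_iff_forall_notMem.2 fun x hx => h0 ((key' x).1 hx))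

theorem sum_prod_bonds {L : ℕ} [NeZero L] (T : Finset (ZMod L)) :
    ∑ τ : ZMod L → ({-1, 1} : Finset ℝ), ∏ i ∈ T, ((τ i : ℝ) * τ (i + 1)) =
      if T = ∅ ∨ T = univ then 2 ^ L else 0 := by
  have hprod : ∀ τ : ZMod L → ({-1, 1} : Finset ℝ), ∏ i ∈ T, ((τ i : ℝ) * τ (i + 1)) =
      ∏ i, (if i ∈ T then (τ i : ℝ) else 1) * (if i - 1 ∈ T then (τ i : ℝ) else 1) := by
    intro τ
    rw [Finset.prod_mul_distrib, Finset.prod_mul_distrib, Fintype.prod_ite_mem,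
      ← Equiv.prod_comp (Equiv.addRight (1 : ZMod L))
        (fun i => if i - 1 ∈ T then (τ i : ℝ) else 1)]
    simp
  rw [Finset.sum_congr rfl fun τ _ => hprod τ,
    sum_prod_spin fun i x => (if i ∈ T then x else 1) * (if i - 1 ∈ T then x else 1)]
  split_ifs with hT
  · have : ∀ i : ZMod L, ((if i ∈ T then (-1 : ℝ) else 1) * (if i - 1 ∈ T then (-1) else 1) +
        (if i ∈ T then 1 else 1) * (if i - 1 ∈ T then 1 else 1)) = 2 := by
      intro i
      rcases hT with rfl | rfl <;> norm_num
    rw [Finset.prod_congr rfl fun i _ => this i, Finset.prod_const, Finset.card_univ, ZMod.card]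
  · obtain ⟨i, hi⟩ : ∃ i, ¬ (i ∈ T ↔ i - 1 ∈ T) := by
      by_contra! h
      exact hT (eq_empty_or_univ_of_shift_invariant T h)
    refine Finset.prod_eq_zero (Finset.mem_univ i) ?_
    by_cases h1 : i ∈ T <;> by_cases h2 : i - 1 ∈ T <;> simp_all

theorem sum_prod_add_bonds {L : ℕ} [NeZero L] (a b : ZMod L → ℝ) :
    ∑ τ : ZMod L → ({-1, 1} : Finset ℝ), ∏ i, (b i * ((τ i : ℝ) * τ (i + 1)) + a i) =
      2 ^ L * (∏ i, a i + ∏ i, b i) := by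
  simp_rw [Finset.prod_add, Finset.prod_mul_distrib (f := b)]
  rw [Finset.sum_comm]
  simp_rw [mul_right_comm, ← Finset.mul_sum, sum_prod_bonds]
  have hne : (∅ : Finset (ZMod L)) ≠ univ := Finset.univ_nonempty.ne_empty.symm
  rw [← Finset.sum_subset (show {∅, univ} ⊆ univ.powerset by simp), Finset.sum_pair hne]
  · simp; ring
  · intro T _ hT
    have : ¬ (T = ∅ ∨ T = univ) := by simpa using hT
    simp [this]

/-- **Total partition function of the completely asymmetric 1D Ising PCA on the
circle.** For the Hamiltonian `H (σ,τ) = -∑ i, (J i * σ i * τ (i+1) + q * σ i * τ i)`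
on spin configurations on `ℤ/Lℤ`, the total partition function is
`Z = ∑ σ τ, exp (-H (σ,τ)) = 4^L * ((cosh q)^L * ∏ i, cosh (J i)
  + (sinh q)^L * ∏ i, sinh (J i))`. -/
theorem one_d_circle_total_partition_function (L : ℕ) [NeZero L] (q : ℝ) (J : ZMod L → ℝ)
    (H : (ZMod L → ({-1, 1} : Finset ℝ)) → (ZMod L → ({-1, 1} : Finset ℝ)) → ℝ)
    (hH : ∀ σ τ, H σ τ =
      -∑ i : ZMod L, (J i * (σ i : ℝ) * (τ (i + 1) : ℝ) + q * (σ i : ℝ) * (τ i : ℝ))) :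
    ∑ σ : ZMod L → ({-1, 1} : Finset ℝ), ∑ τ : ZMod L → ({-1, 1} : Finset ℝ),
        Real.exp (-H σ τ) =
      4 ^ L * ((Real.cosh q) ^ L * ∏ i : ZMod L, Real.cosh (J i) +
               (Real.sinh q) ^ L * ∏ i : ZMod L, Real.sinh (J i)) := by
  have hexp : ∀ σ τ : ZMod L → ({-1, 1} : Finset ℝ), Real.exp (-H σ τ) =
      ∏ i, (Real.cosh (J i) + Real.sinh (J i) * ((σ i : ℝ) * τ (i + 1))) *
        (Real.cosh q + Real.sinh q * ((σ i : ℝ) * τ i)) := by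
    intro σ τ
    have hsign : ∀ s t : ({-1, 1} : Finset ℝ), (s : ℝ) * t = -1 ∨ (s : ℝ) * t = 1 := by
      intro s t
      rcases spin_eq s with hs | hs <;> rcases spin_eq t with ht | ht <;> simp [hs, ht]
    rw [hH, neg_neg, Real.exp_sum]
    refine Finset.prod_congr rfl fun i _ => ?_
    rw [Real.exp_add, mul_assoc, mul_assoc, exp_mul_spin _ _ (hsign _ _),
      exp_mul_spin _ _ (hsign _ _)]
  have hsum : ∀ τ : ZMod L → ({-1, 1} : Finset ℝ),
      ∑ σ : ZMod L → ({-1, 1} : Finset ℝ), Real.exp (-H σ τ) =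
        ∏ i, (2 * (Real.sinh q * Real.sinh (J i)) * ((τ i : ℝ) * τ (i + 1)) +
          2 * (Real.cosh q * Real.cosh (J i))) := by
    intro τ
    simp_rw [hexp]
    rw [sum_prod_spin fun i x => (Real.cosh (J i) + Real.sinh (J i) * (x * τ (i + 1))) *
        (Real.cosh q + Real.sinh q * (x * τ i))]
    exact Finset.prod_congr rfl fun i _ => by ring
  rw [Finset.sum_comm, Finset.sum_congr rfl fun τ _ => hsum τ,
    sum_prod_add_bonds (fun i => 2 * (Real.cosh q * Real.cosh (J i)))
      (fun i => 2 * (Real.sinh q * Real.sinh (J i)))]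
  simp only [Finset.prod_mul_distrib, Finset.prod_const, Finset.card_univ, ZMod.card]
  rw [show (4 : ℝ) = 2 * 2 by norm_num, mul_pow]
  ring
end

section
/- Fix an integer L ≥ 1, real numbers q and J_1,…,J_{L−1}. For the completely asymmetric 1D pair Hamiltonian on the segment of L sites (empty boundary conditions), H(σ,τ) = −∑_{i=1}^{L−1} J_i σ_i τ_{i+1} − q ∑_{i=1}^{L} σ_i τ_i, the total partition function satisfies Z = ∑_{σ,τ∈{−1,+1}^{L}} exp(−H(σ,τ)) = 4^L · (cosh q)^L · ∏_{i=1}^{L−1} cosh J_i. -/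
open Finset

theorem sum_exp_mul_spin (c : ℝ) (b : ({-1, 1} : Finset ℝ)) :
    ∑ a : ({-1, 1} : Finset ℝ), Real.exp (c * ((a : ℝ) * (b : ℝ))) = 2 * Real.cosh c := by
  rw [Finset.sum_coe_sort ({-1, 1} : Finset ℝ) fun a => Real.exp (c * (a * (b : ℝ))),
    Finset.sum_pair (by norm_num), Real.cosh_eq]
  have hb : (b : ℝ) = -1 ∨ (b : ℝ) = 1 := by
    have := b.2
    rwa [Finset.mem_insert, Finset.mem_singleton] at this
  rcases hb with h | h <;> rw [h] <;> ring_nf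

theorem sum_fin_succ_fun {α M : Type*} [Fintype α] [AddCommMonoid M] (n : ℕ)
    (f : (Fin (n + 1) → α) → M) :
    ∑ σ, f σ = ∑ s : Fin n → α, ∑ a : α, f (Fin.cons a s) := by
  rw [Finset.sum_comm, ← Fintype.sum_prod_type']
  exact (Fintype.sum_equiv (Fin.consEquiv fun _ => α) _ _ fun _ => rfl).symm

theorem sum_exp_spin_chain (n : ℕ) (q : ℝ) (J : Fin n → ℝ) :
    ∑ σ : Fin (n + 1) → ({-1, 1} : Finset ℝ), ∑ τ : Fin (n + 1) → ({-1, 1} : Finset ℝ),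
        Real.exp (∑ i : Fin n, J i * ((σ i.castSucc : ℝ) * (τ i.succ : ℝ))
          + q * ∑ i : Fin (n + 1), (σ i : ℝ) * (τ i : ℝ)) =
      4 ^ (n + 1) * (Real.cosh q) ^ (n + 1) * ∏ i : Fin n, Real.cosh (J i) := by
  induction n with
  | zero =>
    simp only [sum_fin_succ_fun 0]
    simp only [Finset.univ_unique, Finset.sum_singleton, Fin.sum_univ_succ, Fin.cons_zero,
      Finset.univ_eq_empty, Finset.sum_empty, Finset.prod_empty, zero_add, add_zero]
    rw [Finset.sum_comm]
    simp only [sum_exp_mul_spin, Finset.sum_const, Finset.card_univ, Fintype.card_coe,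
      Finset.card_pair (show (-1 : ℝ) ≠ 1 by norm_num)]
    norm_num
    ring
  | succ n ih =>
    have peel (s t : Fin (n + 1) → ({-1, 1} : Finset ℝ)) :
        ∑ a : ({-1, 1} : Finset ℝ), ∑ b : ({-1, 1} : Finset ℝ),
          Real.exp (∑ i : Fin (n + 1), J i *
              (((Fin.cons a s : Fin (n + 2) → ({-1, 1} : Finset ℝ)) i.castSucc : ℝ) *
                ((Fin.cons b t : Fin (n + 2) → ({-1, 1} : Finset ℝ)) i.succ : ℝ))
            + q * ∑ i : Fin (n + 2),
              ((Fin.cons a s : Fin (n + 2) → ({-1, 1} : Finset ℝ)) i : ℝ) *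
                ((Fin.cons b t : Fin (n + 2) → ({-1, 1} : Finset ℝ)) i : ℝ)) =
        4 * Real.cosh q * Real.cosh (J 0) *
          Real.exp (∑ i : Fin n, J i.succ * ((s i.castSucc : ℝ) * (t i.succ : ℝ))
            + q * ∑ i : Fin (n + 1), (s i : ℝ) * (t i : ℝ)) := by
      have split (a b : ({-1, 1} : Finset ℝ)) :
          Real.exp (∑ i : Fin (n + 1), J i *
              (((Fin.cons a s : Fin (n + 2) → ({-1, 1} : Finset ℝ)) i.castSucc : ℝ) *
                ((Fin.cons b t : Fin (n + 2) → ({-1, 1} : Finset ℝ)) i.succ : ℝ))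
            + q * ∑ i : Fin (n + 2),
              ((Fin.cons a s : Fin (n + 2) → ({-1, 1} : Finset ℝ)) i : ℝ) *
                ((Fin.cons b t : Fin (n + 2) → ({-1, 1} : Finset ℝ)) i : ℝ)) =
          Real.exp (J 0 * ((a : ℝ) * (t 0 : ℝ))) *
            Real.exp (∑ i : Fin n, J i.succ * ((s i.castSucc : ℝ) * (t i.succ : ℝ))
              + q * ∑ i : Fin (n + 1), (s i : ℝ) * (t i : ℝ)) *
            Real.exp (q * ((b : ℝ) * (a : ℝ))) := by
        rw [← Real.exp_add, ← Real.exp_add, Fin.sum_univ_succ,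
          Fin.sum_univ_succ (n := n + 1)]
        simp only [← Fin.succ_castSucc, Fin.castSucc_zero, Fin.cons_zero, Fin.cons_succ]
        ring_nf
      simp only [split, ← Finset.mul_sum, sum_exp_mul_spin, ← Finset.sum_mul]
      ring
    rw [sum_fin_succ_fun]
    simp_rw [sum_fin_succ_fun (n + 1)]
    refine (Finset.sum_congr rfl fun s _ => Finset.sum_comm.trans
      (Finset.sum_congr rfl fun t _ => peel s t)).trans ?_
    simp_rw [← Finset.mul_sum]
    rw [ih fun i => J i.succ, Fin.prod_univ_succ]
    ring

/-- **Total partition function of the completely asymmetric 1D Ising PCA on the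
segment.** Here the segment has `L = n + 1 ≥ 1` sites (empty boundary conditions),
couplings `J i` between consecutive sites, and
`H (σ,τ) = -∑_{i=1}^{L-1} J i * σ i * τ (i+1) - q * ∑_{i=1}^{L} σ i * τ i`.
Then `Z = ∑ σ τ, exp (-H (σ,τ)) = 4^L * (cosh q)^L * ∏_{i=1}^{L-1} cosh (J i)`. -/
theorem one_d_segment_total_partition_function (n : ℕ) (q : ℝ) (J : Fin n → ℝ)
    (H : (Fin (n + 1) → ({-1, 1} : Finset ℝ)) → (Fin (n + 1) → ({-1, 1} : Finset ℝ)) → ℝ)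
    (hH : ∀ σ τ, H σ τ =
      -∑ i : Fin n, J i * (σ i.castSucc : ℝ) * (τ i.succ : ℝ)
        - q * ∑ i : Fin (n + 1), (σ i : ℝ) * (τ i : ℝ)) :
    ∑ σ : Fin (n + 1) → ({-1, 1} : Finset ℝ), ∑ τ : Fin (n + 1) → ({-1, 1} : Finset ℝ),
        Real.exp (-H σ τ) =
      4 ^ (n + 1) * (Real.cosh q) ^ (n + 1) * ∏ i : Fin n, Real.cosh (J i) := by
  rw [← sum_exp_spin_chain n q J]
  refine Finset.sum_congr rfl fun σ _ => Finset.sum_congr rfl fun τ _ => ?_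
  simp only [hH, mul_assoc]
  ring_nf
end

section
/- Fix an integer L ≥ 2, real numbers q and J_1,…,J_{L−1}, and an index i with 1 ≤ i ≤ L−1. For the completely asymmetric 1D pair Hamiltonian on the segment, H(σ,τ) = −∑_{i=1}^{L−1} J_i σ_i τ_{i+1} − q ∑_{i=1}^{L} σ_i τ_i, with Z = ∑_{σ,τ∈{−1,+1}^{L}} exp(−H(σ,τ)), the stationary current of g_i(σ,τ) = σ_i τ_{i+1} equals 𝒥(g_i) = (1/Z)·∑_{σ,τ∈{−1,+1}^{L}} exp(−H(σ,τ))·(σ_i τ_{i+1} − τ_i σ_{i+1}) = tanh(J_i)·(1 − tanh²(q)). -/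
open Finset

/-- The global spin flip `x ↦ -x` on `{-1, 1}`. -/
def negSpin (x : ({-1, 1} : Finset ℝ)) : ({-1, 1} : Finset ℝ) :=
  ⟨-x, by
    obtain ⟨x, hx⟩ := x
    simp only [Finset.mem_insert, Finset.mem_singleton] at hx ⊢
    rcases hx with rfl | rfl <;> simp⟩

lemma spin_mul_self (x : ({-1, 1} : Finset ℝ)) : (x : ℝ) * x = 1 := by
  obtain ⟨x, hx⟩ := x
  simp only [Finset.mem_insert, Finset.mem_singleton] at hx
  rcases hx with rfl | rfl <;> norm_num

/-- Flip all the spins at sites `i ≥ a`. -/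
def flipFrom {m : ℕ} (a : ℕ) (σ : Fin m → ({-1, 1} : Finset ℝ)) :
    Fin m → ({-1, 1} : Finset ℝ) :=
  fun i => if a ≤ i.val then negSpin (σ i) else σ i

lemma coe_flipFrom {m : ℕ} (a : ℕ) (σ : Fin m → ({-1, 1} : Finset ℝ)) (i : Fin m) :
    (flipFrom a σ i : ℝ) = if a ≤ i.val then -(σ i : ℝ) else σ i := by
  unfold flipFrom
  split_ifs <;> rfl

lemma flipFrom_involutive {m : ℕ} (a : ℕ) :
    Function.Involutive (flipFrom (m := m) a) := by
  intro σ
  funext i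
  apply Subtype.ext
  simp only [coe_flipFrom]
  split_ifs <;> simp

/-- Flip the first configuration from site `a` on and the second one from site `b` on. -/
def flipPair {m : ℕ} (a b : ℕ) :
    Equiv.Perm ((Fin m → ({-1, 1} : Finset ℝ)) × (Fin m → ({-1, 1} : Finset ℝ))) :=
  Equiv.prodCongr (flipFrom_involutive a).toPerm (flipFrom_involutive b).toPerm

lemma flipPair_apply {m : ℕ} (a b : ℕ)
    (x : (Fin m → ({-1, 1} : Finset ℝ)) × (Fin m → ({-1, 1} : Finset ℝ))) :
    flipPair a b x = (flipFrom a x.1, flipFrom b x.2) := rfl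

/-- If a permutation `φ` reverses a sign `s`, fixes `R`, and changes the exponent `E` only through
its term `c * s`, then inserting `s` in the Gibbs sum multiplies it by `tanh c`. -/
lemma sum_exp_mul_sign {α : Type*} [Fintype α] (φ : Equiv.Perm α) (E s R : α → ℝ) (c : ℝ)
    (hs : ∀ x, s x * s x = 1) (hsφ : ∀ x, s (φ x) = -s x) (hR : ∀ x, R (φ x) = R x)
    (hE : ∀ x, E (φ x) = E x - 2 * c * s x) :
    ∑ x, Real.exp (E x) * (s x * R x) = Real.tanh c * ∑ x, Real.exp (E x) * R x := by
  set F : α → ℝ := fun x => Real.exp (E x - c * s x) * R x with hF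
  have hFφ : ∀ x, F (φ x) = F x := by
    intro x
    simp only [hF, hR, hE, hsφ]
    congr 2
    ring
  have hzero : ∑ x, F x * s x = 0 := by
    have h := Equiv.sum_comp φ (fun x => F x * s x)
    simp only [hFφ, hsφ, mul_neg, Finset.sum_neg_distrib] at h
    linarith
  have hexp : ∀ x, Real.exp (E x) * R x = F x * Real.cosh c + F x * s x * Real.sinh c := by
    intro x
    have hsx : Real.exp (c * s x) = Real.cosh c + s x * Real.sinh c := by
      rcases mul_self_eq_one_iff.mp (hs x) with h | h
      · rw [h, mul_one, one_mul, Real.cosh_add_sinh]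
      · rw [h, mul_neg_one, neg_one_mul, ← sub_eq_add_neg, Real.cosh_sub_sinh]
    have : Real.exp (E x) = Real.exp (E x - c * s x) * Real.exp (c * s x) := by
      rw [← Real.exp_add]
      congr 1
      ring
    rw [this, hsx]
    simp only [hF]
    ring
  have hB : ∑ x, Real.exp (E x) * R x = (∑ x, F x) * Real.cosh c := by
    simp only [hexp, Finset.sum_add_distrib, ← Finset.sum_mul, hzero]
    ring
  have hA : ∑ x, Real.exp (E x) * (s x * R x) = (∑ x, F x) * Real.sinh c := by
    have : ∀ x, Real.exp (E x) * (s x * R x) = F x * s x * Real.cosh c + F x * Real.sinh c := by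
      intro x
      linear_combination s x * hexp x + F x * Real.sinh c * hs x
    simp only [this, Finset.sum_add_distrib, ← Finset.sum_mul, hzero]
    ring
  rw [hA, hB, Real.tanh_eq_sinh_div_cosh]
  field_simp [(Real.cosh_pos c).ne']

/-- Minus the completely asymmetric pair Hamiltonian on the segment. -/
def segmentExponent {n : ℕ} (q : ℝ) (J : Fin (n + 1) → ℝ)
    (x : (Fin (n + 2) → ({-1, 1} : Finset ℝ)) × (Fin (n + 2) → ({-1, 1} : Finset ℝ))) : ℝ :=
  ∑ i : Fin (n + 1), J i * (x.1 i.castSucc : ℝ) * (x.2 i.succ : ℝ)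
    + q * ∑ i : Fin (n + 2), (x.1 i : ℝ) * (x.2 i : ℝ)

lemma segmentExponent_flip_bond {n : ℕ} (q : ℝ) (J : Fin (n + 1) → ℝ) (k : Fin (n + 1))
    (x : (Fin (n + 2) → ({-1, 1} : Finset ℝ)) × (Fin (n + 2) → ({-1, 1} : Finset ℝ))) :
    segmentExponent q J (flipPair (k.val + 1) (k.val + 1) x) =
      segmentExponent q J x - 2 * J k * ((x.1 k.castSucc : ℝ) * (x.2 k.succ : ℝ)) := by
  have h1 : ∀ i : Fin (n + 2),
      (flipFrom (k.val + 1) x.1 i : ℝ) * (flipFrom (k.val + 1) x.2 i : ℝ) = x.1 i * x.2 i := by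
    intro i
    simp only [coe_flipFrom]
    split_ifs <;> ring
  have h2 : ∀ i : Fin (n + 1),
      J i * (flipFrom (k.val + 1) x.1 i.castSucc : ℝ) * (flipFrom (k.val + 1) x.2 i.succ : ℝ) =
        J i * (x.1 i.castSucc : ℝ) * (x.2 i.succ : ℝ) -
          if i = k then 2 * J i * ((x.1 i.castSucc : ℝ) * (x.2 i.succ : ℝ)) else 0 := by
    intro i
    simp only [coe_flipFrom, Fin.val_castSucc, Fin.val_succ, Fin.ext_iff]
    split_ifs <;> first | omega | ring
  simp only [segmentExponent, flipPair_apply, h1, h2, Finset.sum_sub_distrib,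
    Finset.sum_ite_eq', Finset.mem_univ, if_true]
  ring

lemma segmentExponent_flip_site {n : ℕ} (q : ℝ) (J : Fin (n + 1) → ℝ) (j : Fin (n + 2))
    (x : (Fin (n + 2) → ({-1, 1} : Finset ℝ)) × (Fin (n + 2) → ({-1, 1} : Finset ℝ))) :
    segmentExponent q J (flipPair j.val (j.val + 1) x) =
      segmentExponent q J x - 2 * q * ((x.1 j : ℝ) * (x.2 j : ℝ)) := by
  have h1 : ∀ i : Fin (n + 2),
      (flipFrom j.val x.1 i : ℝ) * (flipFrom (j.val + 1) x.2 i : ℝ) =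
        x.1 i * x.2 i - if i = j then 2 * ((x.1 i : ℝ) * (x.2 i : ℝ)) else 0 := by
    intro i
    simp only [coe_flipFrom, Fin.ext_iff]
    split_ifs <;> first | omega | ring
  have h2 : ∀ i : Fin (n + 1),
      J i * (flipFrom j.val x.1 i.castSucc : ℝ) * (flipFrom (j.val + 1) x.2 i.succ : ℝ) =
        J i * (x.1 i.castSucc : ℝ) * (x.2 i.succ : ℝ) := by
    intro i
    simp only [coe_flipFrom, Fin.val_castSucc, Fin.val_succ]
    split_ifs <;> first | omega | ring
  simp only [segmentExponent, flipPair_apply, h1, h2, Finset.sum_sub_distrib,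
    Finset.sum_ite_eq', Finset.mem_univ, if_true]
  ring

/-- **Stationary current on the 1D segment.** Here the segment has
`L = n + 2 ≥ 2` sites (empty boundary conditions), and
`H (σ,τ) = -∑_{i=1}^{L-1} J i * σ i * τ (i+1) - q * ∑_{i=1}^{L} σ i * τ i`.
For any bond index `k` (i.e. `1 ≤ k ≤ L - 1`), the stationary current of
`g_k (σ,τ) = σ k * τ (k+1)` equals
`𝒥(g_k) = (1/Z) * ∑ σ τ, exp (-H (σ,τ)) * (σ k * τ (k+1) - τ k * σ (k+1))
        = tanh (J k) * (1 - tanh q ^ 2)`. -/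
theorem one_d_segment_current (n : ℕ) (q : ℝ) (J : Fin (n + 1) → ℝ)
    (H : (Fin (n + 2) → ({-1, 1} : Finset ℝ)) → (Fin (n + 2) → ({-1, 1} : Finset ℝ)) → ℝ)
    (hH : ∀ σ τ, H σ τ =
      -∑ i : Fin (n + 1), J i * (σ i.castSucc : ℝ) * (τ i.succ : ℝ)
        - q * ∑ i : Fin (n + 2), (σ i : ℝ) * (τ i : ℝ))
    (Z : ℝ)
    (hZ : Z = ∑ σ : Fin (n + 2) → ({-1, 1} : Finset ℝ),
      ∑ τ : Fin (n + 2) → ({-1, 1} : Finset ℝ), Real.exp (-H σ τ))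
    (k : Fin (n + 1)) :
    (1 / Z) * ∑ σ : Fin (n + 2) → ({-1, 1} : Finset ℝ),
        ∑ τ : Fin (n + 2) → ({-1, 1} : Finset ℝ),
          Real.exp (-H σ τ) *
            ((σ k.castSucc : ℝ) * (τ k.succ : ℝ) - (τ k.castSucc : ℝ) * (σ k.succ : ℝ)) =
      Real.tanh (J k) * (1 - Real.tanh q ^ 2) := by
  have hE : ∀ σ τ, -H σ τ = segmentExponent q J (σ, τ) := by
    intro σ τ
    rw [hH, segmentExponent]
    ring
  have hsign : ∀ x y : ({-1, 1} : Finset ℝ), ((x : ℝ) * y) * ((x : ℝ) * y) = 1 := by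
    intro x y
    rw [mul_mul_mul_comm, spin_mul_self, spin_mul_self, one_mul]
  have hZ' : Z = ∑ x, Real.exp (segmentExponent q J x) := by
    simp only [hZ, hE, Fintype.sum_prod_type]
  have hZpos : 0 < Z := by
    have : Nonempty ({-1, 1} : Finset ℝ) := ⟨⟨1, by simp⟩⟩
    rw [hZ']
    exact Finset.sum_pos (fun x _ => Real.exp_pos _) Finset.univ_nonempty
  have hbond : ∑ x, Real.exp (segmentExponent q J x) *
      ((x.1 k.castSucc : ℝ) * (x.2 k.succ : ℝ)) = Real.tanh (J k) * Z := by
    have h := sum_exp_mul_sign (flipPair (k.val + 1) (k.val + 1)) (segmentExponent q J)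
      (fun x => (x.1 k.castSucc : ℝ) * (x.2 k.succ : ℝ)) (fun _ => 1) (J k)
      (fun x => hsign _ _) (fun x => by simp [flipPair_apply, coe_flipFrom]) (fun _ => rfl)
      (segmentExponent_flip_bond q J k)
    simpa only [mul_one, ← hZ'] using h
  have hleft := sum_exp_mul_sign (flipPair k.castSucc.val (k.castSucc.val + 1))
    (segmentExponent q J) (fun x => (x.1 k.castSucc : ℝ) * (x.2 k.castSucc : ℝ))
    (fun x => (x.1 k.castSucc : ℝ) * (x.2 k.succ : ℝ)) q
    (fun x => hsign _ _) (fun x => by simp [flipPair_apply, coe_flipFrom])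
    (fun x => by simp [flipPair_apply, coe_flipFrom])
    (segmentExponent_flip_site q J k.castSucc)
  have hright := sum_exp_mul_sign (flipPair k.succ.val (k.succ.val + 1))
    (segmentExponent q J) (fun x => (x.1 k.succ : ℝ) * (x.2 k.succ : ℝ))
    (fun x => (x.1 k.castSucc : ℝ) * (x.2 k.castSucc : ℝ) *
      ((x.1 k.castSucc : ℝ) * (x.2 k.succ : ℝ))) q
    (fun x => hsign _ _) (fun x => by simp [flipPair_apply, coe_flipFrom])
    (fun x => by simp [flipPair_apply, coe_flipFrom])
    (segmentExponent_flip_site q J k.succ)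
  have hpath : ∀ x : (Fin (n + 2) → ({-1, 1} : Finset ℝ)) × (Fin (n + 2) → ({-1, 1} : Finset ℝ)),
      (x.1 k.succ : ℝ) * (x.2 k.succ : ℝ) * ((x.1 k.castSucc : ℝ) * (x.2 k.castSucc : ℝ) *
        ((x.1 k.castSucc : ℝ) * (x.2 k.succ : ℝ))) =
      (x.2 k.castSucc : ℝ) * (x.1 k.succ : ℝ) := by
    intro x
    linear_combination (x.2 k.castSucc : ℝ) * (x.1 k.succ : ℝ) *
      ((x.2 k.succ : ℝ) * (x.2 k.succ : ℝ) * spin_mul_self (x.1 k.castSucc) +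
        spin_mul_self (x.2 k.succ))
  simp only [hpath] at hright
  have hsum : ∑ σ : Fin (n + 2) → ({-1, 1} : Finset ℝ),
      ∑ τ : Fin (n + 2) → ({-1, 1} : Finset ℝ), Real.exp (-H σ τ) *
        ((σ k.castSucc : ℝ) * (τ k.succ : ℝ) - (τ k.castSucc : ℝ) * (σ k.succ : ℝ)) =
      ∑ x, Real.exp (segmentExponent q J x) * ((x.1 k.castSucc : ℝ) * (x.2 k.succ : ℝ)) -
        ∑ x, Real.exp (segmentExponent q J x) *
          ((x.2 k.castSucc : ℝ) * (x.1 k.succ : ℝ)) := by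
    simp only [hE, ← Finset.sum_sub_distrib, ← mul_sub, Fintype.sum_prod_type]
  rw [hsum, hright, hleft, hbond]
  field_simp
end

section
/- Fix an integer N ≥ 1 and a spin configuration σ ∈ {−1,+1}^{(ℤ/Nℤ)²}. Then the number of sites (i,j) such that σ_{i−1,j} = σ_{i,j} and σ_{i,j−1} = σ_{i,j} equals the number of sites (i,j) such that σ_{i+1,j} = σ_{i,j} and σ_{i,j+1} = σ_{i,j}; moreover, the number of sites (i,j) such that σ_{i−1,j} = −σ_{i,j} and σ_{i,j−1} = −σ_{i,j} equals the number of sites (i,j) such that σ_{i+1,j} = −σ_{i,j} and σ_{i,j+1} = −σ_{i,j}. -/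
open Finset

/-- The number of sites at which two fields `u`, `v` both equal `ε` times the spin `s`,
as a sum of pair correlations. -/
lemma card_filter_eq_mul_spin {G : Type*} [Fintype G] (s u v : G → ℝ) (ε : ℝ)
    (hs : ∀ x, s x = -1 ∨ s x = 1) (hu : ∀ x, u x = -1 ∨ u x = 1)
    (hv : ∀ x, v x = -1 ∨ v x = 1) (hε : ε = -1 ∨ ε = 1) :
    ((univ.filter fun x => u x = ε * s x ∧ v x = ε * s x).card : ℝ) =
      (∑ _x : G, (1 : ℝ) + ε * ∑ x, u x * s x + ε * ∑ x, v x * s x + ∑ x, u x * v x) / 4 := by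
  rw [Finset.card_filter, Nat.cast_sum, Finset.mul_sum, Finset.mul_sum,
    ← Finset.sum_add_distrib, ← Finset.sum_add_distrib, ← Finset.sum_add_distrib,
    Finset.sum_div]
  refine Finset.sum_congr rfl fun x _ => ?_
  rcases hs x with h₁ | h₁ <;> rcases hu x with h₂ | h₂ <;> rcases hv x with h₃ | h₃ <;>
    rcases hε with rfl | rfl <;> norm_num [h₁, h₂, h₃]

/-- On a finite abelian group, a spin configuration has as many elbows in the directions
`-a`, `-b` as in the directions `a`, `b`. -/
lemma card_elbows_neg_eq {G : Type*} [Fintype G] [AddCommGroup G] (s : G → ℝ) (ε : ℝ)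
    (hs : ∀ x, s x = -1 ∨ s x = 1) (hε : ε = -1 ∨ ε = 1) (a b : G) :
    (univ.filter fun x => s (x - a) = ε * s x ∧ s (x - b) = ε * s x).card =
      (univ.filter fun x => s (x + a) = ε * s x ∧ s (x + b) = ε * s x).card := by
  have pair (c : G) : ∑ x, s (x - c) * s x = ∑ x, s (x + c) * s x := by
    rw [← Equiv.sum_comp (Equiv.addRight c)]
    simp [mul_comm]
  have diag : ∑ x, s (x - a) * s (x - b) = ∑ x, s (x + a) * s (x + b) := by
    rw [← Equiv.sum_comp (Equiv.addRight (a + b))]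
    refine Finset.sum_congr rfl fun x _ => ?_
    rw [Equiv.coe_addRight, show x + (a + b) - a = x + b by abel,
      show x + (a + b) - b = x + a by abel, mul_comm]
  have key := card_filter_eq_mul_spin s (fun x => s (x - a)) (fun x => s (x - b)) ε
    hs (fun x => hs _) (fun x => hs _) hε
  rw [pair a, pair b, diag, ← card_filter_eq_mul_spin s (fun x => s (x + a))
    (fun x => s (x + b)) ε hs (fun x => hs _) (fun x => hs _) hε] at key
  exact_mod_cast key

/-- **Equality of SW- and NE-oriented elbow counts on the torus.**
For any spin configuration `σ` on the `N × N` torus, the number of sites whose two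
SW neighbours both agree with (resp. both disagree with) the site's spin equals the
number of sites whose two NE neighbours both agree with (resp. both disagree with)
the site's spin. -/
theorem two_d_torus_elbow_counts (N : ℕ) [NeZero N]
    (σ : ZMod N × ZMod N → ({-1, 1} : Finset ℝ)) :
    ((Finset.univ : Finset (ZMod N × ZMod N)).filter
        (fun p => (σ (p.1 - 1, p.2) : ℝ) = (σ p : ℝ) ∧
                  (σ (p.1, p.2 - 1) : ℝ) = (σ p : ℝ))).card =
      ((Finset.univ : Finset (ZMod N × ZMod N)).filter
        (fun p => (σ (p.1 + 1, p.2) : ℝ) = (σ p : ℝ) ∧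
                  (σ (p.1, p.2 + 1) : ℝ) = (σ p : ℝ))).card ∧
    ((Finset.univ : Finset (ZMod N × ZMod N)).filter
        (fun p => (σ (p.1 - 1, p.2) : ℝ) = -(σ p : ℝ) ∧
                  (σ (p.1, p.2 - 1) : ℝ) = -(σ p : ℝ))).card =
      ((Finset.univ : Finset (ZMod N × ZMod N)).filter
        (fun p => (σ (p.1 + 1, p.2) : ℝ) = -(σ p : ℝ) ∧
                  (σ (p.1, p.2 + 1) : ℝ) = -(σ p : ℝ))).card := by
  have hs (p : ZMod N × ZMod N) : (σ p : ℝ) = -1 ∨ (σ p : ℝ) = 1 := by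
    simpa only [Finset.mem_insert, Finset.mem_singleton] using (σ p).2
  have key (ε : ℝ) (hε : ε = -1 ∨ ε = 1) :=
    card_elbows_neg_eq (fun p => (σ p : ℝ)) ε hs hε (1, 0) (0, 1)
  constructor
  · simpa [Prod.sub_def, Prod.add_def] using key 1 (Or.inr rfl)
  · simpa [Prod.sub_def, Prod.add_def] using key (-1) (Or.inl rfl)
end

section
/- Fix an integer N ≥ 1 and real numbers J and q. Consider the irreversible 2D PCA on {−1,+1}^{(ℤ/Nℤ)²} with pair Hamiltonian H(σ,τ) = −J ∑_{(i,j)∈(ℤ/Nℤ)²} ( σ_{i,j} τ_{i,j+1} + σ_{i,j} τ_{i+1,j} ) − q ∑_{(i,j)} σ_{i,j} τ_{i,j}, transition probabilities P(σ,τ) = exp(−H(σ,τ))/Z_σ where Z_σ = ∑_τ exp(−H(σ,τ)), and Z = ∑_σ Z_σ. Then π(σ) = Z_σ/Z is a stationary distribution: ∑_σ π(σ)·P(σ,τ) = π(τ) for every τ. -/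
open Finset

/-- The partition function of independent `±1` spins in an external field factorizes. -/
lemma sum_exp_field {V : Type*} [Fintype V] [DecidableEq V] (h : V → ℝ) :
    ∑ σ : V → ({-1, 1} : Finset ℝ), Real.exp (∑ p, h p * (σ p : ℝ)) =
      ∏ p, (2 * Real.cosh (h p)) := by
  have single (x : ℝ) :
      2 * Real.cosh x = ∑ s : ({-1, 1} : Finset ℝ), Real.exp (x * (s : ℝ)) := by
    rw [Finset.sum_coe_sort ({-1, 1} : Finset ℝ) (fun s => Real.exp (x * s)),
      Finset.sum_pair (by norm_num), Real.cosh_eq, mul_neg_one, mul_one]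
    ring
  simp only [single, Finset.prod_univ_sum, Fintype.piFinset_univ, Real.exp_sum]

/-- The effective energy of three spins, symmetric in `a` and `b` and even, is a combination of
pair interactions. -/
lemma exists_two_mul_cosh_eq_exp (J q : ℝ) :
    ∃ K₀ K₁ K₂ : ℝ, ∀ a b c : ({-1, 1} : Finset ℝ),
      2 * Real.cosh (J * ((a : ℝ) + b) + q * c) =
        Real.exp (K₀ + K₁ * ((a : ℝ) * b) + K₂ * ((a : ℝ) * c + b * c)) := by
  set L : ℝ → ℝ := fun x => Real.log (2 * Real.cosh x) with hL
  have hexp (x : ℝ) : 2 * Real.cosh x = Real.exp (L x) :=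
    (Real.exp_log (mul_pos two_pos (Real.cosh_pos x))).symm
  have hneg (x : ℝ) : L (-x) = L x := by simp only [hL, Real.cosh_neg]
  refine ⟨((L (2 * J + q) + L (2 * J - q)) / 2 + L q) / 2,
    ((L (2 * J + q) + L (2 * J - q)) / 2 - L q) / 2,
    (L (2 * J + q) - L (2 * J - q)) / 4, ?_⟩
  rintro ⟨a, ha⟩ ⟨b, hb⟩ ⟨c, hc⟩
  rw [hexp]
  congr 1
  have h₁ := hneg (2 * J + q)
  have h₂ := hneg (2 * J - q)
  have h₃ := hneg q
  simp only [Finset.mem_insert, Finset.mem_singleton] at ha hb hc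
  rcases ha with rfl | rfl <;> rcases hb with rfl | rfl <;> rcases hc with rfl | rfl <;>
    ring_nf at h₁ h₂ h₃ ⊢ <;> linarith

/-- The interaction weights summed over the first configuration and over the second one agree. -/
lemma sum_exp_interaction_comm {V : Type*} [Fintype V] [DecidableEq V] [AddCommGroup V]
    (u v : V) (J q : ℝ) (τ : V → ({-1, 1} : Finset ℝ)) :
    ∑ σ : V → ({-1, 1} : Finset ℝ),
        Real.exp (∑ p, (J * ((τ (p + u) : ℝ) + τ (p + v)) + q * τ p) * (σ p : ℝ)) =
      ∑ σ : V → ({-1, 1} : Finset ℝ),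
        Real.exp (∑ p, (J * ((τ (p - u) : ℝ) + τ (p - v)) + q * τ p) * (σ p : ℝ)) := by
  obtain ⟨K₀, K₁, K₂, hK⟩ := exists_two_mul_cosh_eq_exp J q
  simp only [sum_exp_field, hK, ← Real.exp_sum, Finset.sum_add_distrib, ← Finset.mul_sum]
  have shift (w : V) (f : V → ℝ) : ∑ p, f (p + w) = ∑ p, f p :=
    Equiv.sum_comp (Equiv.addRight w) f
  have huv : ∑ p, (τ (p + u) : ℝ) * τ (p + v) = ∑ p, (τ (p - u) : ℝ) * τ (p - v) := by
    rw [← shift (u + v) fun p => (τ (p - u) : ℝ) * τ (p - v)]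
    refine Finset.sum_congr rfl fun p _ => ?_
    rw [show p + (u + v) - u = p + v by abel, show p + (u + v) - v = p + u by abel, mul_comm]
  have hpair (w : V) : ∑ p, (τ (p + w) : ℝ) * τ p = ∑ p, (τ (p - w) : ℝ) * τ p := by
    rw [← shift w fun p => (τ (p - w) : ℝ) * τ p]
    refine Finset.sum_congr rfl fun p _ => ?_
    rw [add_sub_cancel_right, mul_comm]
  rw [huv, hpair u, hpair v]

/-- **Stationarity of `π σ = Z_σ / Z` for the irreversible 2D Ising PCA on the
torus.** For the completely asymmetric Hamiltonian
`H (σ,τ) = -J * ∑ (i,j), (σ (i,j) * τ (i,j+1) + σ (i,j) * τ (i+1,j))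
  - q * ∑ (i,j), σ (i,j) * τ (i,j)`, the PCA `P σ τ = exp (-H (σ,τ)) / Zs σ` has
stationary distribution `π σ = Zs σ / Z`. -/
theorem two_d_torus_stationary (N : ℕ) [NeZero N] (J q : ℝ)
    (H : (ZMod N × ZMod N → ({-1, 1} : Finset ℝ)) →
         (ZMod N × ZMod N → ({-1, 1} : Finset ℝ)) → ℝ)
    (hH : ∀ σ τ, H σ τ =
      -J * ∑ p : ZMod N × ZMod N,
          ((σ p : ℝ) * (τ (p.1, p.2 + 1) : ℝ) + (σ p : ℝ) * (τ (p.1 + 1, p.2) : ℝ))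
        - q * ∑ p : ZMod N × ZMod N, (σ p : ℝ) * (τ p : ℝ))
    (Zs : (ZMod N × ZMod N → ({-1, 1} : Finset ℝ)) → ℝ)
    (hZs : ∀ σ, Zs σ = ∑ τ : ZMod N × ZMod N → ({-1, 1} : Finset ℝ), Real.exp (-H σ τ))
    (P : (ZMod N × ZMod N → ({-1, 1} : Finset ℝ)) →
         (ZMod N × ZMod N → ({-1, 1} : Finset ℝ)) → ℝ)
    (hP : ∀ σ τ, P σ τ = Real.exp (-H σ τ) / Zs σ)
    (Z : ℝ) (hZ : Z = ∑ σ : ZMod N × ZMod N → ({-1, 1} : Finset ℝ), Zs σ)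
    (π : (ZMod N × ZMod N → ({-1, 1} : Finset ℝ)) → ℝ)
    (hπ : ∀ σ, π σ = Zs σ / Z) :
    ∀ τ : ZMod N × ZMod N → ({-1, 1} : Finset ℝ),
      ∑ σ : ZMod N × ZMod N → ({-1, 1} : Finset ℝ), π σ * P σ τ = π τ := by
  have left (σ τ : ZMod N × ZMod N → ({-1, 1} : Finset ℝ)) : -H σ τ =
      ∑ p, (J * ((τ (p + (0, 1)) : ℝ) + τ (p + (1, 0))) + q * τ p) * (σ p : ℝ) := by
    rw [hH, neg_sub, neg_mul, sub_neg_eq_add, Finset.mul_sum, Finset.mul_sum,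
      ← Finset.sum_add_distrib]
    refine Finset.sum_congr rfl fun p _ => ?_
    rw [show p + (0, 1) = (p.1, p.2 + 1) by ext <;> simp,
      show p + (1, 0) = (p.1 + 1, p.2) by ext <;> simp]
    ring
  have right (σ τ : ZMod N × ZMod N → ({-1, 1} : Finset ℝ)) : -H τ σ =
      ∑ p, (J * ((τ (p - (0, 1)) : ℝ) + τ (p - (1, 0))) + q * τ p) * (σ p : ℝ) := by
    have shift (w : ZMod N × ZMod N) :
        ∑ p, (τ (p - w) : ℝ) * (σ p : ℝ) = ∑ p, (τ p : ℝ) * (σ (p + w) : ℝ) := by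
      rw [← Equiv.sum_comp (Equiv.addRight w)]
      simp
    have expand (f g : ZMod N × ZMod N → ℝ) (h k : ZMod N × ZMod N → ℝ) :
        ∑ p, (J * (f p + g p) + q * h p) * k p =
          J * (∑ p, f p * k p + ∑ p, g p * k p) + q * ∑ p, h p * k p := by
      simp only [Finset.mul_sum, ← Finset.sum_add_distrib]
      exact Finset.sum_congr rfl fun p _ => by ring
    rw [left]
    rw [expand (fun p => (τ (p - (0, 1)) : ℝ)) (fun p => (τ (p - (1, 0)) : ℝ))
      (fun p => (τ p : ℝ)) (fun p => (σ p : ℝ)), shift, shift,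
      expand (fun p => (σ (p + (0, 1)) : ℝ)) (fun p => (σ (p + (1, 0)) : ℝ))
      (fun p => (σ p : ℝ)) (fun p => (τ p : ℝ))]
    simp only [mul_comm]
  have balance (τ : ZMod N × ZMod N → ({-1, 1} : Finset ℝ)) :
      ∑ σ, Real.exp (-H σ τ) = Zs τ := by
    rw [hZs]
    simp only [right _ τ, left _ τ]
    exact sum_exp_interaction_comm _ _ J q τ
  have Zs_pos (σ : ZMod N × ZMod N → ({-1, 1} : Finset ℝ)) : 0 < Zs σ := by
    rw [hZs]
    exact Finset.sum_pos (fun _ _ => Real.exp_pos _) ⟨σ, Finset.mem_univ σ⟩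
  intro τ
  rw [hπ, ← balance, Finset.sum_div]
  refine Finset.sum_congr rfl fun σ _ => ?_
  rw [hπ, hP, div_mul_div_comm, mul_comm Z, mul_div_mul_left _ _ (Zs_pos σ).ne']
end
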